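/- Let A be a type and m : A → A → A → A a Mal'cev operation that commutes with itself. Let R be the ring of idempotent binary operations commuting with m (with operations (r + s) a b := m (r a b) b (s a b), (-r) a b := m b (r a b) b, (r * s) a b := r (s a b) b, zero the second projection, one the first projection). Let M be the set of unary operations u : A → A that commute with m, with (u + v) b := m (u b) b (v b), (-u) b := m b (u b) b, zero the identity function, and scalar action (r • u) b := r (u b) b for r ∈ R. Then M is closed under these operations and forms a left R-module. -/

import Mathlib

/-- A binary operation `r` commutes with the ternary operation `m`. -/
def CommutesBin {A : Type*} (m : A → A → A → A) (r : A → A → A) : Prop :=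
  ∀ x₁ x₂ y₁ y₂ z₁ z₂ : A,
    r (m x₁ y₁ z₁) (m x₂ y₂ z₂) = m (r x₁ x₂) (r y₁ y₂) (r z₁ z₂)

/-- Membership in the ring of idempotent binary operations commuting with `m`. -/
def InRing {A : Type*} (m : A → A → A → A) (r : A → A → A) : Prop :=
  CommutesBin m r ∧ ∀ b : A, r b b = b

/-- Membership in the module of unary operations commuting with `m`. -/
def InMod {A : Type*} (m : A → A → A → A) (u : A → A) : Prop :=
  ∀ x y z : A, u (m x y z) = m (u x) (u y) (u z)

/-- In a self-commuting Mal'cev algebra, `m x b y` is symmetric in `x` and `y`. -/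
theorem malcev_add_comm {A : Type*} {m : A → A → A → A}
    (hm : ∀ x y : A, m x x y = y ∧ m y x x = y)
    (hself : ∀ x₁ x₂ x₃ y₁ y₂ y₃ z₁ z₂ z₃ : A,
      m (m x₁ x₂ x₃) (m y₁ y₂ y₃) (m z₁ z₂ z₃)
        = m (m x₁ y₁ z₁) (m x₂ y₂ z₂) (m x₃ y₃ z₃)) (b x y : A) :
    m x b y = m y b x := by
  simpa [hm] using hself b b x b b b y b b

/-- In a self-commuting Mal'cev algebra, `x + y = m x b y` is associative. -/
theorem malcev_add_assoc {A : Type*} {m : A → A → A → A}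
    (hm : ∀ x y : A, m x x y = y ∧ m y x x = y)
    (hself : ∀ x₁ x₂ x₃ y₁ y₂ y₃ z₁ z₂ z₃ : A,
      m (m x₁ x₂ x₃) (m y₁ y₂ y₃) (m z₁ z₂ z₃)
        = m (m x₁ y₁ z₁) (m x₂ y₂ z₂) (m x₃ y₃ z₃)) (b x y z : A) :
    m (m x b y) b z = m x b (m y b z) := by
  simpa [hm] using hself x b y b b b b b z

/-- In a self-commuting Mal'cev algebra, `m b x b` is the inverse of `x` for `x + y = m x b y`. -/
theorem malcev_neg_add {A : Type*} {m : A → A → A → A}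
    (hm : ∀ x y : A, m x x y = y ∧ m y x x = y)
    (hself : ∀ x₁ x₂ x₃ y₁ y₂ y₃ z₁ z₂ z₃ : A,
      m (m x₁ x₂ x₃) (m y₁ y₂ y₃) (m z₁ z₂ z₃)
        = m (m x₁ y₁ z₁) (m x₂ y₂ z₂) (m x₃ y₃ z₃)) (b x : A) :
    m (m b x b) b x = b := by
  simpa [hm] using hself b x b b b b b b x

/-- The unary operations commuting with a self-commuting Mal'cev
operation `m` are closed under `(u + v) b := m (u b) b (v b)`,
`(-u) b := m b (u b) b`, the identity function (the zero), and the scalar action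
`(r • u) b := r (u b) b` by idempotent binary operations commuting with `m`, and
they satisfy the axioms of a left module over the ring of such binary
operations. -/
theorem stmt5 {A : Type*} (m : A → A → A → A)
    (hm : ∀ x y : A, m x x y = y ∧ m y x x = y)
    (hself : ∀ x₁ x₂ x₃ y₁ y₂ y₃ z₁ z₂ z₃ : A,
      m (m x₁ x₂ x₃) (m y₁ y₂ y₃) (m z₁ z₂ z₃)
        = m (m x₁ y₁ z₁) (m x₂ y₂ z₂) (m x₃ y₃ z₃)) :
    let radd : (A → A → A) → (A → A → A) → (A → A → A) :=
      fun r s => fun a b => m (r a b) b (s a b)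
    let rmul : (A → A → A) → (A → A → A) → (A → A → A) :=
      fun r s => fun a b => r (s a b) b
    let rone : A → A → A := fun a _ => a
    let madd : (A → A) → (A → A) → (A → A) := fun u v => fun b => m (u b) b (v b)
    let mneg : (A → A) → (A → A) := fun u => fun b => m b (u b) b
    let mzero : A → A := fun b => b
    let smul : (A → A → A) → (A → A) → (A → A) := fun r u => fun b => r (u b) b
    -- closure
    (∀ u v, InMod m u → InMod m v → InMod m (madd u v)) ∧
    (∀ u, InMod m u → InMod m (mneg u)) ∧
    InMod m mzero ∧
    (∀ r u, InRing m r → InMod m u → InMod m (smul r u)) ∧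
    -- additive abelian group axioms
    (∀ u v w, InMod m u → InMod m v → InMod m w →
      madd (madd u v) w = madd u (madd v w)) ∧
    (∀ u v, InMod m u → InMod m v → madd u v = madd v u) ∧
    (∀ u, InMod m u → madd mzero u = u) ∧
    (∀ u, InMod m u → madd u mzero = u) ∧
    (∀ u, InMod m u → madd (mneg u) u = mzero) ∧
    (∀ u, InMod m u → madd u (mneg u) = mzero) ∧
    -- module axioms
    (∀ u, InMod m u → smul rone u = u) ∧
    (∀ r s u, InRing m r → InRing m s → InMod m u →
      smul (rmul r s) u = smul r (smul s u)) ∧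
    (∀ r u v, InRing m r → InMod m u → InMod m v →
      smul r (madd u v) = madd (smul r u) (smul r v)) ∧
    (∀ r s u, InRing m r → InRing m s → InMod m u →
      smul (radd r s) u = madd (smul r u) (smul s u)) ∧
    (∀ r, InRing m r → smul r mzero = mzero) ∧
    (∀ u, InMod m u → smul (fun _ b => b) u = mzero) := by
  intro radd rmul rone madd mneg mzero smul
  refine ⟨?_, ?_, ?_, ?_, ?_, ?_, ?_, ?_, ?_, ?_, ?_, ?_, ?_, ?_, ?_, ?_⟩
  · intro u v hu hv x y z
    change m (u (m x y z)) (m x y z) (v (m x y z)) = _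
    rw [hu, hv, hself]
  · intro u hu x y z
    change m (m x y z) (u (m x y z)) (m x y z) = _
    rw [hu, hself]
  · exact fun _ _ _ => rfl
  · intro r u hr hu x y z
    change r (u (m x y z)) (m x y z) = _
    rw [hu, hr.1]
  · exact fun u v w _ _ _ => funext fun b => malcev_add_assoc hm hself b (u b) (v b) (w b)
  · exact fun u v _ _ => funext fun b => malcev_add_comm hm hself b (u b) (v b)
  · exact fun u _ => funext fun b => (hm b (u b)).1
  · exact fun u _ => funext fun b => (hm b (u b)).2
  · exact fun u _ => funext fun b => malcev_neg_add hm hself b (u b)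
  · exact fun u _ => funext fun b =>
      (malcev_add_comm hm hself b _ _).trans (malcev_neg_add hm hself b (u b))
  · exact fun _ _ => rfl
  · exact fun _ _ _ _ _ _ => rfl
  · intro r u v hr _ _
    funext b
    have h := hr.1 (u b) b b b (v b) b
    rwa [(hm b b).1, hr.2 b] at h
  · exact fun _ _ _ _ _ _ => rfl
  · exact fun r hr => funext hr.2
  · exact fun _ _ => rfl
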